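/- (Proposition 3, combined form) Let P = (h, χ) be a pattern over D, and let F be the map sending each signal S = (f, ψ) to the function ĉ_{S,P}. Then F is a GENEO with respect to the group of planar translations; concretely: (i) for every signal S = (f, ψ) and every v ∈ ℝ², ĉ_{(f∘τ_v, ψ∘τ_v), P}(p) = ĉ_{(f,ψ),P}(p + v) for all p ∈ ℝ²; and (ii) for all signals S₁ = (f₁, ψ) and S₂ = (f₂, ψ) with the same reliability function and every C ≥ 0 with |f₁(q) − f₂(q)| ≤ C for all q, one has |ĉ_{S₁,P}(p) − ĉ_{S₂,P}(p)| ≤ C for all p ∈ ℝ². -/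

import Mathlib

open MeasureTheory Set

noncomputable section

/-- The plane ℝ². -/
abbrev Plane := EuclideanSpace ℝ (Fin 2)

/-- The normalized measure μ(A) = λ̄(A) / λ̄(D). -/
def mu (D : Set Plane) : Measure Plane := (volume D)⁻¹ • volume

/-- The indicator function χ of the set D. -/
def chi (D : Set Plane) : Plane → ℝ := D.indicator (fun _ => (1 : ℝ))

/-- The reliability integral 𝒜_{S,P}(p) = ∫ ψ(p+q) χ(q) dμ(q). -/
def Acal (D : Set Plane) (ψ : Plane → ℝ) (p : Plane) : ℝ :=
  ∫ q, ψ (p + q) * chi D q ∂(mu D)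

/-- The comparison integral 𝒮_{S,P}(p) = ∫ |f(p+q) − h(q)| ψ(p+q) χ(q) dμ(q). -/
def Scal (D : Set Plane) (f ψ h : Plane → ℝ) (p : Plane) : ℝ :=
  ∫ q, |f (p + q) - h q| * ψ (p + q) * chi D q ∂(mu D)

/-- The similarity coefficient ĉ_{S,P} = 𝒜_{S,P} − 𝒮_{S,P}. -/
def chat (D : Set Plane) (f ψ h : Plane → ℝ) (p : Plane) : ℝ :=
  Acal D ψ p - Scal D f ψ h p

theorem mu_self {D : Set Plane} (hD0 : 0 < volume D) (hDfin : volume D < ⊤) : mu D D = 1 := by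
  rw [mu, Measure.smul_apply, smul_eq_mul]
  exact ENNReal.inv_mul_cancel hD0.ne' hDfin.ne

theorem integrable_chi {D : Set Plane} (hD : MeasurableSet D) (hD0 : 0 < volume D)
    (hDfin : volume D < ⊤) : Integrable (chi D) (mu D) := by
  refine (integrable_indicator_iff hD).2 (integrableOn_const ?_)
  simp [mu_self hD0 hDfin]

theorem integral_chi {D : Set Plane} (hD : MeasurableSet D) (hD0 : 0 < volume D)
    (hDfin : volume D < ⊤) : ∫ q, chi D q ∂(mu D) = 1 := by
  simp [chi, integral_indicator hD, measureReal_def, mu_self hD0 hDfin]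

theorem chi_nonneg (D : Set Plane) (q : Plane) : 0 ≤ chi D q :=
  indicator_nonneg (fun _ _ => zero_le_one) q

theorem integrable_scal_integrand {D : Set Plane} (hD : MeasurableSet D) (hD0 : 0 < volume D)
    (hDfin : volume D < ⊤) {f ψ h : Plane → ℝ} (hf : Measurable f) (hψ : Measurable ψ)
    (hh : Measurable h) (hf01 : ∀ q, f q ∈ Icc (0 : ℝ) 1) (hψ01 : ∀ q, ψ q ∈ Icc (0 : ℝ) 1)
    (hh01 : ∀ q, h q ∈ Icc (0 : ℝ) 1) (p : Plane) :
    Integrable (fun q => |f (p + q) - h q| * ψ (p + q) * chi D q) (mu D) := by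
  refine (integrable_chi hD hD0 hDfin).bdd_mul (c := 1) ?_ (.of_forall fun q => ?_)
  · have hdiff : Measurable fun q => f (p + q) - h q := by fun_prop
    exact (hdiff.abs.mul (by fun_prop)).aestronglyMeasurable
  · rw [Real.norm_eq_abs, abs_mul, abs_abs]
    refine mul_le_one₀ (abs_sub_le_of_nonneg_of_le (hf01 _).1 (hf01 _).2 (hh01 _).1 (hh01 _).2)
      (abs_nonneg _) ?_
    rw [abs_of_nonneg (hψ01 _).1]
    exact (hψ01 _).2

theorem chat_translate (D : Set Plane) (f ψ h : Plane → ℝ) (v p : Plane) :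
    chat D (fun q => f (q + v)) (fun q => ψ (q + v)) h p = chat D f ψ h (p + v) := by
  simp only [chat, Acal, Scal, add_right_comm]

theorem abs_chat_sub_chat_le {D : Set Plane} (hD : MeasurableSet D) (hD0 : 0 < volume D)
    (hDfin : volume D < ⊤) {f₁ f₂ ψ h : Plane → ℝ} (hf₁ : Measurable f₁) (hf₂ : Measurable f₂)
    (hψ : Measurable ψ) (hh : Measurable h) (hf₁01 : ∀ q, f₁ q ∈ Icc (0 : ℝ) 1)
    (hf₂01 : ∀ q, f₂ q ∈ Icc (0 : ℝ) 1) (hψ01 : ∀ q, ψ q ∈ Icc (0 : ℝ) 1)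
    (hh01 : ∀ q, h q ∈ Icc (0 : ℝ) 1) {C : ℝ} (hfC : ∀ q, |f₁ q - f₂ q| ≤ C)
    (p : Plane) : |chat D f₁ ψ h p - chat D f₂ ψ h p| ≤ C := by
  have hbound : ∀ q, ‖|f₂ (p + q) - h q| * ψ (p + q) * chi D q
      - |f₁ (p + q) - h q| * ψ (p + q) * chi D q‖ ≤ C * chi D q := fun q => by
    have hdist : |(|f₂ (p + q) - h q| - |f₁ (p + q) - h q|)| ≤ C := by
      refine (abs_abs_sub_abs_le_abs_sub _ _).trans ?_
      rw [sub_sub_sub_cancel_right, abs_sub_comm]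
      exact hfC _
    rw [← sub_mul, ← sub_mul, Real.norm_eq_abs, abs_mul, abs_mul, abs_of_nonneg (hψ01 _).1,
      abs_of_nonneg (chi_nonneg D q)]
    exact mul_le_mul_of_nonneg_right
      ((mul_le_of_le_one_right (abs_nonneg _) (hψ01 _).2).trans hdist) (chi_nonneg D q)
  calc |chat D f₁ ψ h p - chat D f₂ ψ h p|
      = ‖∫ q, (|f₂ (p + q) - h q| * ψ (p + q) * chi D q
          - |f₁ (p + q) - h q| * ψ (p + q) * chi D q) ∂(mu D)‖ := by
        rw [integral_sub (integrable_scal_integrand hD hD0 hDfin hf₂ hψ hh hf₂01 hψ01 hh01 p)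
          (integrable_scal_integrand hD hD0 hDfin hf₁ hψ hh hf₁01 hψ01 hh01 p),
          Real.norm_eq_abs, chat, chat, sub_sub_sub_cancel_left, Scal, Scal]
    _ ≤ ∫ q, C * chi D q ∂(mu D) :=
        norm_integral_le_of_norm_le ((integrable_chi hD hD0 hDfin).const_mul C)
          (.of_forall hbound)
    _ = C := by rw [integral_const_mul, integral_chi hD hD0 hDfin, mul_one]

/-- Proposition 3, combined: the operator F : S ↦ ĉ_{S,P} is a GENEO
w.r.t. the group of planar translations: (i) it is translation-equivariant, and
(ii) it is non-expansive w.r.t. the supremum norm. -/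
theorem stmt_12 (D : Set Plane) (hD : MeasurableSet D)
    (hD0 : 0 < volume D) (hDfin : volume D < ⊤)
    (h : Plane → ℝ) (hh : Measurable h) (hh01 : ∀ q, h q ∈ Icc (0 : ℝ) 1) :
    (∀ f ψ : Plane → ℝ, Measurable f → Measurable ψ →
      (∀ q, f q ∈ Icc (0 : ℝ) 1) → (∀ q, ψ q ∈ Icc (0 : ℝ) 1) →
      ∀ v p : Plane,
        chat D (fun q => f (q + v)) (fun q => ψ (q + v)) h p = chat D f ψ h (p + v)) ∧
    (∀ f₁ f₂ ψ : Plane → ℝ, Measurable f₁ → Measurable f₂ → Measurable ψ →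
      (∀ q, f₁ q ∈ Icc (0 : ℝ) 1) → (∀ q, f₂ q ∈ Icc (0 : ℝ) 1) →
      (∀ q, ψ q ∈ Icc (0 : ℝ) 1) →
      ∀ C : ℝ, 0 ≤ C → (∀ q, |f₁ q - f₂ q| ≤ C) →
      ∀ p : Plane, |chat D f₁ ψ h p - chat D f₂ ψ h p| ≤ C) := by
  exact ⟨fun f ψ _ _ _ _ v p => chat_translate D f ψ h v p,
    fun _ _ _ hf₁ hf₂ hψ hf₁01 hf₂01 hψ01 _ _ hfC p =>
      abs_chat_sub_chat_le hD hD0 hDfin hf₁ hf₂ hψ hh hf₁01 hf₂01 hψ01 hh01 hfC p⟩
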